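/- Let F be a field and q ∈ F a nonzero element of infinite multiplicative order; write [n] = (qⁿ − q⁻ⁿ)/(q − q⁻¹) for n ∈ ℤ. Let p, m be integers with p ≠ 0, m ≠ 0, p ≠ m, p ≠ −1, m ≠ −1 and p + m ≠ −1, and set e₁ = −(p+m), e₂ = p+m+2, e₃ = p−m+2, e₄ = m−p+2 (these are pairwise distinct integers with pairwise even sums and differences, summing to 6). Then Σ_{s=1}^{4} q^{e_s} · [e_s + 1] · Π_{t ≠ s} [ (e_s+e_t)/2 ] / [ (e_s−e_t)/2 ] = q⁷ · ([e₁] + [e₂] + [e₃] + [e₄]). -/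

import Mathlib

/-- The quantum integer `[n] = (qⁿ - q⁻ⁿ)/(q - q⁻¹)`. -/
def qint {F : Type*} [Field F] (q : F) (n : ℤ) : F :=
  (q ^ n - q ^ (-n)) / (q - q⁻¹)

/-- The half-sum over half-difference ratio of quantum integers, in terms of `q ^ a` and `q ^ b`. -/
theorem qint_half_add_div_qint_half_sub {F : Type*} [Field F] {q : F} (hq : q ≠ 0)
    (hq2 : q - q⁻¹ ≠ 0) {a b : ℤ} (hab : 2 ∣ a + b) :
    qint q ((a + b) / 2) / qint q ((a - b) / 2) = (q ^ a * q ^ b - 1) / (q ^ a - q ^ b) := by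
  obtain ⟨u, hu⟩ := hab
  obtain ⟨v, rfl⟩ : ∃ v, a = u + v := ⟨a - u, by ring⟩
  obtain rfl : b = u - v := by omega
  have h1 : (u + v + (u - v)) / 2 = u := by omega
  have h2 : (u + v - (u - v)) / 2 = v := by omega
  have hU : q ^ u ≠ 0 := zpow_ne_zero _ hq
  have hV : q ^ v ≠ 0 := zpow_ne_zero _ hq
  rw [h1, h2, qint, qint, div_div_div_cancel_right₀ hq2, zpow_neg, zpow_neg, zpow_add₀ hq,
    zpow_sub₀ hq]
  generalize q ^ u = U at *
  generalize q ^ v = V at *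
  have hnum : U * V * (U / V) - 1 = (U - U⁻¹) * U := by field_simp
  have hden : U * V - U / V = (V - V⁻¹) * U := by field_simp
  rw [hnum, hden, mul_div_mul_right _ _ hU]

/-- A Lagrange-interpolation identity in four variables. -/
theorem sum_lagrange_four {F : Type*} [Field F] (r a b c d : F)
    (hab : a - b ≠ 0) (hac : a - c ≠ 0) (had : a - d ≠ 0)
    (hbc : b - c ≠ 0) (hbd : b - d ≠ 0) (hcd : c - d ≠ 0) :
    (r * a ^ 2 - 1) * ((a * b - 1) / (a - b) * ((a * c - 1) / (a - c) * ((a * d - 1) / (a - d)))) +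
    (r * b ^ 2 - 1) * ((b * a - 1) / (b - a) * ((b * c - 1) / (b - c) * ((b * d - 1) / (b - d)))) +
    (r * c ^ 2 - 1) * ((c * a - 1) / (c - a) * ((c * b - 1) / (c - b) * ((c * d - 1) / (c - d)))) +
    (r * d ^ 2 - 1) * ((d * a - 1) / (d - a) * ((d * b - 1) / (d - b) * ((d * c - 1) / (d - c))))
      = r * ((a + b + c + d) * (a * b * c * d) -
          (a * b * c + a * b * d + a * c * d + b * c * d)) := by
  rw [← neg_sub a b, ← neg_sub a c, ← neg_sub a d, ← neg_sub b c, ← neg_sub b d, ← neg_sub c d]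
  simp only [div_neg]
  field_simp
  ring

/-- for `q` of infinite multiplicative order and integers `p, m`
with `p, m ≠ 0`, `p ≠ m`, `p, m ≠ -1`, `p + m ≠ -1`, setting
`e = (-(p+m), p+m+2, p-m+2, m-p+2)`, one has the computational identity
`Σ_s q^(e s)·[e s + 1]·Π_{t ≠ s} [(e s + e t)/2]/[(e s - e t)/2]
  = q⁷·([e₁] + [e₂] + [e₃] + [e₄])`. -/
theorem stmt9 {F : Type*} [Field F]
    (q : F) (hq : q ≠ 0) (hord : ∀ k : ℤ, k ≠ 0 → q ^ k ≠ 1)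
    (p m : ℤ) (hp : p ≠ 0) (hm : m ≠ 0) (hpm : p ≠ m)
    (hp1 : p ≠ -1) (hm1 : m ≠ -1) (hpm1 : p + m ≠ -1)
    (e : Fin 4 → ℤ) (he : e = ![-(p + m), p + m + 2, p - m + 2, m - p + 2]) :
    ∑ s : Fin 4, q ^ (e s) * qint q (e s + 1) *
        ∏ t ∈ Finset.univ.erase s,
          qint q ((e s + e t) / 2) / qint q ((e s - e t) / 2)
      = q ^ (7 : ℤ) * ∑ s : Fin 4, qint q (e s) := by
  have hne : ∀ a b : ℤ, a ≠ b → q ^ a - q ^ b ≠ 0 := fun a b hab h ↦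
    hord (a - b) (sub_ne_zero.2 hab) <| by
      rw [zpow_sub₀ hq, sub_eq_zero.1 h, div_self (zpow_ne_zero _ hq)]
  have hq2 : q - q⁻¹ ≠ 0 := by simpa using hne 1 (-1) (by decide)
  have hterm : ∀ a : ℤ, q ^ a * qint q (a + 1) =
      (q ^ 2 * (q ^ a) ^ 2 - 1) * (q * (q - q⁻¹))⁻¹ := fun a ↦ by
    have ha : q ^ a ≠ 0 := zpow_ne_zero _ hq
    rw [qint, neg_add, zpow_add₀ hq, zpow_add₀ hq, zpow_neg, zpow_neg, zpow_one, mul_inv,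
      ← mul_assoc, ← div_eq_mul_inv, mul_div_assoc']
    field_simp
  have h0 : e 0 = -(p + m) := by simp [he]
  have h1 : e 1 = p + m + 2 := by simp [he]
  have h2 : e 2 = p - m + 2 := by simp [he]
  have h3 : e 3 = m - p + 2 := by simp [he]
  have heven : ∀ s t, 2 ∣ e s + e t := by
    intro s t
    fin_cases s <;> fin_cases t <;> simp [h0, h1, h2, h3] <;> omega
  have hprod : q ^ e 0 * q ^ e 1 * q ^ e 2 * q ^ e 3 = q ^ 6 := by
    rw [← zpow_add₀ hq, ← zpow_add₀ hq, ← zpow_add₀ hq, h0, h1, h2, h3, ← zpow_natCast]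
    congr 1
    push_cast
    ring
  have e0 : ∀ f : Fin 4 → F, ∏ t ∈ Finset.univ.erase 0, f t = f 1 * (f 2 * f 3) := fun f ↦ by
    rw [show Finset.univ.erase (0 : Fin 4) = {1, 2, 3} by decide]
    simp [Finset.prod_insert]
  have e1 : ∀ f : Fin 4 → F, ∏ t ∈ Finset.univ.erase 1, f t = f 0 * (f 2 * f 3) := fun f ↦ by
    rw [show Finset.univ.erase (1 : Fin 4) = {0, 2, 3} by decide]
    simp [Finset.prod_insert]
  have e2 : ∀ f : Fin 4 → F, ∏ t ∈ Finset.univ.erase 2, f t = f 0 * (f 1 * f 3) := fun f ↦ by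
    rw [show Finset.univ.erase (2 : Fin 4) = {0, 1, 3} by decide]
    simp [Finset.prod_insert]
  have e3 : ∀ f : Fin 4 → F, ∏ t ∈ Finset.univ.erase 3, f t = f 0 * (f 1 * f 2) := fun f ↦ by
    rw [show Finset.univ.erase (3 : Fin 4) = {0, 1, 2} by decide]
    simp [Finset.prod_insert]
  simp only [hterm, qint_half_add_div_qint_half_sub hq hq2 (heven _ _)]
  have key := sum_lagrange_four (q ^ 2) (q ^ e 0) (q ^ e 1) (q ^ e 2) (q ^ e 3)
    (hne _ _ (by omega)) (hne _ _ (by omega)) (hne _ _ (by omega))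
    (hne _ _ (by omega)) (hne _ _ (by omega)) (hne _ _ (by omega))
  have hx : ∀ s, q ^ e s ≠ 0 := fun s ↦ zpow_ne_zero _ hq
  have g0 := hx 0
  have g1 := hx 1
  have g2 := hx 2
  have g3 := hx 3
  rw [Fin.sum_univ_four, Fin.sum_univ_four, e0, e1, e2, e3]
  simp only [qint, zpow_neg]
  generalize q ^ e 0 = a at *
  generalize q ^ e 1 = b at *
  generalize q ^ e 2 = c at *
  generalize q ^ e 3 = d at *
  have k0 : a⁻¹ * q ^ 6 = b * c * d := by rw [← hprod]; field_simp
  have k1 : b⁻¹ * q ^ 6 = a * c * d := by rw [← hprod]; field_simp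
  have k2 : c⁻¹ * q ^ 6 = a * b * d := by rw [← hprod]; field_simp
  have k3 : d⁻¹ * q ^ 6 = a * b * c := by rw [← hprod]; field_simp
  have hqq : q ^ 2 * (q * (q - q⁻¹))⁻¹ = q * (q - q⁻¹)⁻¹ := by
    rw [mul_inv]
    field_simp
  rw [show q ^ (7 : ℤ) = q ^ 7 from zpow_natCast q 7]
  simp only [div_eq_mul_inv _ (q - q⁻¹)]
  generalize (q * (q - q⁻¹))⁻¹ = K at *
  generalize (q - q⁻¹)⁻¹ = L at *
  linear_combination K * key +
    ((a + b + c + d) * (a * b * c * d) - (a * b * c + a * b * d + a * c * d + b * c * d)) * hqq +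
    q * L * ((a + b + c + d) * hprod + k0 + k1 + k2 + k3)
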